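/- Let m, l, C be integers with 1 ≤ l ≤ m/2 and C ≥ 1. On a common finite probability space, let S_1, …, S_m be independent and identically distributed random variables with values in a finite set; let E¹ be an event independent of (S_1,…,S_m); let M be a random variable taking at most 2^C distinct values; let E² be an event with Pr[E² | E¹] ≥ 9/10; and for each Q ∈ [m] let B_Q and G_Q be {0,1}-valued random variables. Let ρ = (ρ_1,…,ρ_l) be a uniformly random injective sequence of indices in [m] and J uniform on [l], with (ρ, J) independent of all of the above. Set Z := (M, ρ_{<J}, G_{ρ_{<J}}, B_{ρ_{<J}}, S_{ρ_{<J}}, J) (where ρ_{<J} := (ρ_1,…,ρ_{J−1}) and similarly for the G, B, S entries) and E := E¹ ∧ E². Then E_{(z,q) ∼ (Z, ρ_J) | E}[ D( law(S_q | Z=z, ρ_J=q, E) ‖ law(S_q) ) ] ≤ 5(C + l)/m. -/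

import Mathlib

noncomputable section
open scoped Classical
open Finset

/-- Probability of an event under a probability mass function `p` on a finite sample space. -/
def prEvt {Ω : Type*} [Fintype Ω] (p : Ω → ℝ) (E : Set Ω) : ℝ :=
  ∑ ω, if ω ∈ E then p ω else 0

/-- Conditional probability of `E` given `F`. -/
def cprEvt {Ω : Type*} [Fintype Ω] (p : Ω → ℝ) (E F : Set Ω) : ℝ :=
  prEvt p (E ∩ F) / prEvt p F

/-- KL divergence (base 2) between two distributions on a finite set. -/
def klDiv2 {α : Type*} [Fintype α] (μ ν : α → ℝ) : ℝ :=
  ∑ x, μ x * Real.logb 2 (μ x / ν x)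

/-- The random variable `Z := (M, ρ_{<J}, G_{ρ_{<J}}, B_{ρ_{<J}}, S_{ρ_{<J}}, J)`,
where "`<J`" prefixes are encoded as `Option`-valued tuples of length `l`. -/
def Zvar {Ω α κ : Type*} {m l : ℕ} (S : Fin m → Ω → α) (M : Ω → κ)
    (B G : Fin m → Ω → Bool) (ρ : Ω → Fin l → Fin m) (J : Ω → Fin l) :
    Ω → κ × (Fin l → Option (Fin m)) × (Fin l → Option Bool) × (Fin l → Option Bool) ×
      (Fin l → Option α) × Fin l :=
  fun ω =>
    (M ω,
     fun i => if i < J ω then some (ρ ω i) else none,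
     fun i => if i < J ω then some (G (ρ ω i) ω) else none,
     fun i => if i < J ω then some (B (ρ ω i) ω) else none,
     fun i => if i < J ω then some (S (ρ ω i) ω) else none,
     J ω)


lemma prEvt_nonneg' {Ω : Type*} [Fintype Ω] (p : Ω → ℝ) (hp : ∀ ω, 0 ≤ p ω) (E : Set Ω) :
    0 ≤ prEvt p E := by
  unfold prEvt
  exact Finset.sum_nonneg fun ω _ => by split_ifs <;> simp [hp]

lemma prEvt_mono' {Ω : Type*} [Fintype Ω] (p : Ω → ℝ) (hp : ∀ ω, 0 ≤ p ω) {E F : Set Ω}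
    (h : E ⊆ F) : prEvt p E ≤ prEvt p F := by
  unfold prEvt
  refine Finset.sum_le_sum fun ω _ => ?_
  by_cases h1 : ω ∈ E
  · simp [h1, h h1]
  · simp only [h1, if_false]
    split_ifs <;> simp [hp]

lemma le_prEvt {Ω : Type*} [Fintype Ω] (p : Ω → ℝ) (hp : ∀ ω, 0 ≤ p ω) {E : Set Ω}
    {ω : Ω} (h : ω ∈ E) : p ω ≤ prEvt p E := by
  unfold prEvt
  have := Finset.single_le_sum (f := fun ω => if ω ∈ E then p ω else 0)
    (fun ω _ => by split_ifs <;> simp [hp]) (Finset.mem_univ ω)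
  simpa [h] using this

lemma prEvt_eq_mul {Ω : Type*} [Fintype Ω] (p : Ω → ℝ) (E : Set Ω) :
    prEvt p E = ∑ ω, p ω * (if ω ∈ E then 1 else 0) := by
  unfold prEvt
  exact Finset.sum_congr rfl fun ω _ => by split_ifs <;> simp

/-- Grouping a sum over the sample space by the value of a random variable. -/
lemma sum_fiber {Ω β : Type*} [Fintype Ω] [Fintype β] (p : Ω → ℝ) (V : Ω → β) (F : β → ℝ)
    (E : Set Ω) :
    ∑ v, prEvt p (E ∩ {ω | V ω = v}) * F v = ∑ ω, if ω ∈ E then p ω * F (V ω) else 0 := by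
  unfold prEvt
  simp_rw [Finset.sum_mul]
  rw [Finset.sum_comm]
  refine Finset.sum_congr rfl fun ω _ => ?_
  by_cases h : ω ∈ E
  · rw [Finset.sum_eq_single (V ω)]
    · simp [h]
    · intro b _ hb
      simp [h, Ne.symm hb]
    · simp
  · simp [h]

lemma decouple {Ω ξ β : Type*} [Fintype Ω] [Fintype ξ] [Fintype β] (p : Ω → ℝ)
    (X : Ω → ξ) (V : Ω → β)
    (hind : ∀ x v, prEvt p {ω | X ω = x ∧ V ω = v} =
      prEvt p {ω | X ω = x} * prEvt p {ω | V ω = v}) (F : ξ → β → ℝ) :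
    ∑ ω, p ω * F (X ω) (V ω) = ∑ x, prEvt p {ω | X ω = x} * ∑ ω, p ω * F x (V ω) := by
  have h1 := sum_fiber p (fun ω => (X ω, V ω)) (fun y => F y.1 y.2) Set.univ
  have h2 := fun x => sum_fiber p V (F x) Set.univ
  simp only [Set.univ_inter, Set.mem_univ, if_true] at h1 h2
  rw [← h1, Fintype.sum_prod_type]
  refine Finset.sum_congr rfl fun x _ => ?_
  rw [← h2, Finset.mul_sum]
  refine Finset.sum_congr rfl fun v _ => ?_
  rw [← mul_assoc, ← hind]
  simp only [Prod.mk.injEq]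

/-- Sum of a product where the factors outside `A` depend only on the coordinates in `A`. -/
lemma sum_prod_le_one {ι α : Type*} [Fintype ι] [DecidableEq ι] [Fintype α] (P : ι → Prop)
    (ν : ι → α → ℝ) (μ : (ι → α) → ι → α → ℝ)
    (hν : ∀ i x, 0 ≤ ν i x) (hν1 : ∀ i, ∑ x, ν i x ≤ 1)
    (hμ : ∀ f i x, 0 ≤ μ f i x) (hμ1 : ∀ f i, ∑ x, μ f i x ≤ 1)
    (hdep : ∀ f f' : ι → α, (∀ i, P i → f i = f' i) → μ f = μ f') :
    ∑ f : ι → α, ∏ i, (if P i then ν i (f i) else μ f i (f i)) ≤ 1 := by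
  rw [← (Equiv.piEquivPiSubtypeProd P (fun _ => α)).symm.sum_comp, Fintype.sum_prod_type]
  have key : ∀ (f1 : {i // P i} → α),
      ∑ f2 : {i // ¬ P i} → α, ∏ i, (if P i then
          ν i ((Equiv.piEquivPiSubtypeProd P (fun _ => α)).symm (f1, f2) i) else
          μ ((Equiv.piEquivPiSubtypeProd P (fun _ => α)).symm (f1, f2)) i
            ((Equiv.piEquivPiSubtypeProd P (fun _ => α)).symm (f1, f2) i)) ≤
        ∏ i : {i // P i}, ν i (f1 i) := by
    intro f1
    by_cases hne : Nonempty ({i // ¬ P i} → α)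
    swap
    · rw [not_nonempty_iff] at hne
      simp only [Finset.univ_eq_empty, Finset.sum_empty]
      exact Finset.prod_nonneg fun i _ => hν _ _
    obtain ⟨f20⟩ := hne
    set μ0 := μ ((Equiv.piEquivPiSubtypeProd P (fun _ => α)).symm (f1, f20)) with hμ0
    have hμe : ∀ f2, μ ((Equiv.piEquivPiSubtypeProd P (fun _ => α)).symm (f1, f2)) = μ0 := by
      intro f2
      apply hdep
      intro i hi
      simp [Equiv.piEquivPiSubtypeProd, hi]
    have : ∀ f2 : {i // ¬ P i} → α, ∏ i, (if P i then
          ν i ((Equiv.piEquivPiSubtypeProd P (fun _ => α)).symm (f1, f2) i) else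
          μ ((Equiv.piEquivPiSubtypeProd P (fun _ => α)).symm (f1, f2)) i
            ((Equiv.piEquivPiSubtypeProd P (fun _ => α)).symm (f1, f2) i)) =
        (∏ i : {i // P i}, ν i (f1 i)) * ∏ i : {i // ¬ P i}, μ0 i (f2 i) := by
      intro f2
      rw [← Fintype.prod_subtype_mul_prod_subtype P]
      congr 1
      · refine Finset.prod_congr rfl fun i _ => ?_
        simp [Equiv.piEquivPiSubtypeProd, i.2]
      · refine Finset.prod_congr rfl fun i _ => ?_
        rw [hμe]
        simp [Equiv.piEquivPiSubtypeProd, i.2]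
    simp_rw [this]
    rw [← Finset.mul_sum]
    refine mul_le_of_le_one_right (Finset.prod_nonneg fun i _ => hν _ _) ?_
    rw [← Fintype.prod_sum (fun (i : {i // ¬ P i}) x => μ0 i x)]
    exact Finset.prod_le_one (fun i _ => Finset.sum_nonneg fun x _ => hμ _ _ _)
      (fun i _ => hμ1 _ _)
  refine (Finset.sum_le_sum fun f1 _ => key f1).trans ?_
  rw [← Fintype.prod_sum (fun (i : {i // P i}) x => ν i x)]
  exact Finset.prod_le_one (fun i _ => Finset.sum_nonneg fun x _ => hν _ _)
      (fun i _ => hν1 _)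

/-- Double counting via swapping the `j`-th entry. -/
lemma swap_sum {m l : ℕ} (j : Fin l) (g : (Fin l → Fin m) → Fin m → ℝ)
    (hg : ∀ r r' q, (∀ i, i < j → r i = r' i) → g r q = g r' q) :
    ∑ r ∈ univ.filter (fun r : Fin l → Fin m => Function.Injective r),
      ∑ q ∈ univ.filter (fun q => ¬ ∃ i, i < j ∧ r i = q), g r q =
    ((m : ℝ) - j) * ∑ r ∈ univ.filter (fun r : Fin l → Fin m => Function.Injective r),
      g r (r j) := by
  have hcard : ∀ r : Fin l → Fin m, Function.Injective r →
      ((univ.filter (fun q => ¬ ∃ i, i < j ∧ r i = q)).card : ℝ) = (m : ℝ) - j := by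
    intro r hr
    have h1 : univ.filter (fun q => ¬ ∃ i, i < j ∧ r i = q) = ((Finset.Iio j).image r)ᶜ := by
      ext q; simp
    rw [h1, Finset.card_compl, Finset.card_image_of_injective _ hr, Fin.card_Iio, Fintype.card_fin,
      Nat.cast_sub]
    have := Fintype.card_le_of_injective r hr
    simp at this
    omega
  rw [Finset.mul_sum]
  have h2 : ∑ r ∈ univ.filter (fun r : Fin l → Fin m => Function.Injective r),
      ((m : ℝ) - j) * g r (r j) =
      ∑ r ∈ univ.filter (fun r : Fin l → Fin m => Function.Injective r),
      ∑ q ∈ univ.filter (fun q => ¬ ∃ i, i < j ∧ r i = q), g r (r j) := by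
    refine Finset.sum_congr rfl fun r hr => ?_
    rw [Finset.sum_const, nsmul_eq_mul, hcard r (by simpa using hr)]
  rw [h2, Finset.sum_sigma', Finset.sum_sigma']
  have hfix : ∀ (r : Fin l → Fin m) (q : Fin m), Function.Injective r →
      (∀ x, x < j → r x ≠ q) → ∀ x, x < j → Equiv.swap (r j) q (r x) = r x := by
    intro r q hr hq x hx
    exact Equiv.swap_apply_of_ne_of_ne (fun h => hx.ne (hr h)) (hq x hx)
  refine Finset.sum_nbij' (fun x => ⟨Equiv.swap (x.1 j) x.2 ∘ x.1, x.1 j⟩)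
    (fun x => ⟨Equiv.swap (x.1 j) x.2 ∘ x.1, x.1 j⟩) ?_ ?_ ?_ ?_ ?_
  · rintro ⟨r, q⟩ h
    simp only [mem_sigma, mem_filter, mem_univ, true_and, not_exists, not_and] at h ⊢
    refine ⟨(Equiv.injective _).comp h.1, fun x hx => ?_⟩
    simp only [Function.comp]
    rw [hfix r q h.1 h.2 x hx]
    exact fun h' => hx.ne (h.1 h')
  · rintro ⟨r, q⟩ h
    simp only [mem_sigma, mem_filter, mem_univ, true_and, not_exists, not_and] at h ⊢
    refine ⟨(Equiv.injective _).comp h.1, fun x hx => ?_⟩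
    simp only [Function.comp]
    rw [hfix r q h.1 h.2 x hx]
    exact fun h' => hx.ne (h.1 h')
  · rintro ⟨r, q⟩ h
    simp only [Function.comp, Equiv.swap_apply_left]
    congr 1
    funext x
    rw [Equiv.swap_comm]
    exact Equiv.swap_apply_self _ _ _
  · rintro ⟨r, q⟩ h
    simp only [Function.comp, Equiv.swap_apply_left]
    congr 1
    funext x
    rw [Equiv.swap_comm]
    exact Equiv.swap_apply_self _ _ _
  · rintro ⟨r, q⟩ h
    simp only [mem_sigma, mem_filter, mem_univ, true_and, not_exists, not_and] at h
    simp only [Function.comp, Equiv.swap_apply_left]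
    apply hg
    intro x hx
    exact (hfix r q h.1 h.2 x hx).symm

lemma sum_cpr_le_one {Ω α : Type*} [Fintype Ω] [Fintype α] (p : Ω → ℝ) 
    (X : Ω → α) (F : Set Ω) : ∑ x, cprEvt p {ω | X ω = x} F ≤ 1 := by
  unfold cprEvt
  rw [← Finset.sum_div]
  have := sum_fiber p X (fun _ => 1) F
  simp only [mul_one] at this
  simp_rw [Set.inter_comm _ F]
  rw [this]
  exact div_self_le_one _

/-- Pointwise log-likelihood ratio for a fixed index sequence `a` and position `j`. -/
def LLR {Ω α κ : Type*} [Fintype Ω] {m l : ℕ} (p : Ω → ℝ) (S : Fin m → Ω → α) (M : Ω → κ)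
    (B G : Fin m → Ω → Bool) (E : Set Ω) (a : Fin l → Fin m) (j : Fin l) (q : Fin m) (ω : Ω) : ℝ :=
  Real.logb 2 (cprEvt p {ω' | S q ω' = S q ω}
    ({ω' | Zvar S M B G (fun _ => a) (fun _ => j) ω' =
      Zvar S M B G (fun _ => a) (fun _ => j) ω} ∩ E) / prEvt p {ω' | S q ω' = S q ω})

lemma key_bound {Ω α κ : Type*} [Fintype Ω] [Fintype α] [Fintype κ]
    (p : Ω → ℝ) (hp : ∀ ω, 0 ≤ p ω) (hsum : ∑ ω, p ω = 1)
    (m l C : ℕ) (S : Fin m → Ω → α)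
    (hSindep : ∀ f : Fin m → α,
      prEvt p {ω | ∀ i, S i ω = f i} = ∏ i, prEvt p {ω | S i ω = f i})
    (E1 : Set Ω)
    (hE1indep : ∀ f : Fin m → α,
      prEvt p (E1 ∩ {ω | ∀ i, S i ω = f i}) =
        prEvt p E1 * prEvt p {ω | ∀ i, S i ω = f i})
    (M : Ω → κ)
    (hM : (Finset.univ.filter fun k : κ => prEvt p {ω | M ω = k} ≠ 0).card ≤ 2 ^ C)
    (E : Set Ω) (hEE : E ⊆ E1) (hE : prEvt p E1 ≤ 2 * prEvt p E)
    (B G : Fin m → Ω → Bool) (a : Fin l → Fin m) (j : Fin l) :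
    ∑ q ∈ univ.filter (fun q => ¬ ∃ i, i < j ∧ a i = q),
      ∑ ω, (if ω ∈ E then p ω * LLR p S M B G E a j q ω else 0) ≤
    prEvt p E * ((C : ℝ) + 2 * l + 1) := by
  let U : Ω → κ × (Fin l → Bool) × (Fin l → Bool) × (Fin m → α) := fun ω =>
    (M ω, fun i => G (a i) ω, fun i => B (a i) ω, fun i => S i ω)
  let Φ : κ × (Fin l → Bool) × (Fin l → Bool) × (Fin m → α) →
      κ × (Fin l → Option (Fin m)) × (Fin l → Option Bool) × (Fin l → Option Bool) ×
      (Fin l → Option α) × Fin l := fun u =>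
    (u.1, fun i => if i < j then some (a i) else none,
      fun i => if i < j then some (u.2.1 i) else none,
      fun i => if i < j then some (u.2.2.1 i) else none,
      fun i => if i < j then some (u.2.2.2 (a i)) else none, j)
  let μ : κ × (Fin l → Bool) × (Fin l → Bool) × (Fin m → α) → Fin m → α → ℝ := fun u q x =>
    cprEvt p {ω' | S q ω' = x}
      ({ω' | Zvar S M B G (fun _ => a) (fun _ => j) ω' = Φ u} ∩ E)
  let ν : Fin m → α → ℝ := fun q x => prEvt p {ω' | S q ω' = x}
  let R : κ × (Fin l → Bool) × (Fin l → Bool) × (Fin m → α) → Fin m → ℝ := fun u q =>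
    μ u q (u.2.2.2 q) / ν q (u.2.2.2 q)
  let P : Fin m → Prop := fun q => ∃ i, i < j ∧ a i = q
  let Pi : κ × (Fin l → Bool) × (Fin l → Bool) × (Fin m → α) → ℝ := fun u =>
    ∏ q ∈ univ.filter (fun q => ¬ P q), R u q
  have hLL : ∀ q ω, LLR p S M B G E a j q ω = Real.logb 2 (R (U ω) q) := fun q ω => rfl
  have hμ0 : ∀ u q x, 0 ≤ μ u q x := fun u q x =>
    div_nonneg (prEvt_nonneg' p hp _) (prEvt_nonneg' p hp _)
  have hν0 : ∀ q x, 0 ≤ ν q x := fun q x => prEvt_nonneg' p hp _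
  have hR0 : ∀ u q, 0 ≤ R u q := fun u q => div_nonneg (hμ0 _ _ _) (hν0 _ _)
  have hPi0 : ∀ u, 0 ≤ Pi u := fun u => Finset.prod_nonneg fun q _ => hR0 _ _
  have hν1 : ∀ q, ∑ x, ν q x ≤ 1 := by
    intro q
    have := sum_fiber p (S q) (fun _ => 1) Set.univ
    simp only [mul_one, Set.univ_inter, Set.mem_univ, if_true, hsum] at this
    exact this.le
  have hinner : ∀ k g b, ∑ f : Fin m → α, (∏ i, ν i (f i)) * Pi (k, g, b, f) ≤ 1 := by
    intro k g b
    refine le_trans (Finset.sum_le_sum fun f _ => ?_)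
      (sum_prod_le_one P ν (fun f => μ (k, g, b, f)) hν0 hν1 (fun f => hμ0 _)
        (fun f i => sum_cpr_le_one p (S i) _) ?_)
    · simp only [Pi]
      rw [Finset.prod_filter, ← Finset.prod_mul_distrib]
      refine Finset.prod_le_prod (fun i _ => ?_) (fun i _ => ?_)
      · refine mul_nonneg (hν0 _ _) ?_
        split_ifs
        · exact zero_le_one
        · exact hR0 _ _
      · by_cases h : P i
        · simp [h]
        · simp only [h, not_false_eq_true, if_true, if_false, R]
          by_cases h0 : ν i (f i) = 0
          · rw [h0, zero_mul]; exact hμ0 _ _ _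
          · rw [mul_div_cancel₀ _ h0]
    · intro f f' hff
      have : Φ (k, g, b, f) = Φ (k, g, b, f') := by
        simp only [Φ, Prod.mk.injEq, true_and, and_true]
        funext i
        split_ifs with hi
        · rw [hff _ ⟨i, hi, rfl⟩]
        · rfl
      simp only [μ, this]
  have hE10 := prEvt_nonneg' p hp E1
  have hmean : ∑ ω, (if ω ∈ E then p ω * Pi (U ω) else 0) ≤
      prEvt p E1 * (2 : ℝ) ^ (C + 2 * l) := by
    rw [← sum_fiber p U Pi E]
    have h1 : ∀ u : κ × (Fin l → Bool) × (Fin l → Bool) × (Fin m → α),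
        prEvt p (E ∩ {ω | U ω = u}) * Pi u ≤
        (if prEvt p {ω | M ω = u.1} ≠ 0 then prEvt p E1 else 0) *
          ((∏ i, ν i (u.2.2.2 i)) * Pi u) := by
      intro u
      rw [← mul_assoc]
      refine mul_le_mul_of_nonneg_right ?_ (hPi0 u)
      split_ifs with hk
      · simp only [ν]
        rw [← hSindep, ← hE1indep]
        apply prEvt_mono' p hp
        rintro ω ⟨hω, rfl⟩
        exact ⟨hEE hω, fun i => rfl⟩
      · rw [zero_mul]
        rw [not_not] at hk
        rw [← hk]
        apply prEvt_mono' p hp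
        rintro ω ⟨hω, rfl⟩
        rfl
    refine (Finset.sum_le_sum fun u _ => h1 u).trans ?_
    simp only [Fintype.sum_prod_type]
    have h2 : ∀ k, ∑ g : Fin l → Bool, ∑ b : Fin l → Bool, ∑ f : Fin m → α,
        (if prEvt p {ω | M ω = k} ≠ 0 then prEvt p E1 else 0) *
          ((∏ i, ν i (f i)) * Pi (k, g, b, f)) ≤
        (if prEvt p {ω | M ω = k} ≠ 0 then prEvt p E1 * (2 ^ l * 2 ^ l) else 0) := by
      intro k
      have h3 : ∀ g b, ∑ f : Fin m → α,
        (if prEvt p {ω | M ω = k} ≠ 0 then prEvt p E1 else 0) *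
          ((∏ i, ν i (f i)) * Pi (k, g, b, f)) ≤
          (if prEvt p {ω | M ω = k} ≠ 0 then prEvt p E1 else 0) := by
        intro g b
        rw [← Finset.mul_sum]
        refine mul_le_of_le_one_right ?_ (hinner k g b)
        split_ifs <;> simp [hE10]
      refine (Finset.sum_le_sum fun g _ => Finset.sum_le_sum fun b _ => h3 g b).trans ?_
      simp only [Finset.sum_const, Finset.card_univ, Fintype.card_fun, Fintype.card_bool,
        Fintype.card_fin, nsmul_eq_mul]
      push_cast
      split_ifs
      · apply le_of_eq; ring
      · simp
    refine (Finset.sum_le_sum fun k _ => h2 k).trans ?_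
    rw [← Finset.sum_filter, Finset.sum_const, nsmul_eq_mul]
    have hM' : ((Finset.univ.filter fun k : κ => prEvt p {ω | M ω = k} ≠ 0).card : ℝ) ≤ 2 ^ C := by
      exact_mod_cast hM
    calc _ ≤ (2 : ℝ) ^ C * (prEvt p E1 * (2 ^ l * 2 ^ l)) :=
          mul_le_mul_of_nonneg_right hM' (by positivity)
      _ = _ := by rw [pow_add, pow_mul']; ring
  have hlog2 : 0 < Real.log 2 := Real.log_pos (by norm_num)
  set K : ℝ := 2 ^ (C + 2 * l + 1) with hK
  have hKpos : 0 < K := by positivity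
  have hmean2 : ∑ ω, (if ω ∈ E then p ω * Pi (U ω) else 0) ≤ prEvt p E * K := by
    refine hmean.trans ?_
    rw [hK, pow_succ]
    have : (0 : ℝ) ≤ 2 ^ (C + 2 * l) := by positivity
    nlinarith
  rw [Finset.sum_comm]
  have hpt : ∀ ω, ∑ q ∈ univ.filter (fun q => ¬ ∃ i, i < j ∧ a i = q),
      (if ω ∈ E then p ω * LLR p S M B G E a j q ω else 0) ≤
      (if ω ∈ E then p ω else 0) * ((C : ℝ) + 2 * l + 1 - 1 / Real.log 2) +
      (if ω ∈ E then p ω * Pi (U ω) else 0) / (K * Real.log 2) := by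
    intro ω
    by_cases hω : ω ∈ E
    swap
    · simp [hω]
    simp only [hω, if_true]
    rcases (hp ω).eq_or_lt with h0 | h0
    · simp [← h0]
    have hRpos : ∀ q, 0 < R (U ω) q := by
      intro q
      have e1 : 0 < ν q (S q ω) := h0.trans_le (le_prEvt p hp (by rfl))
      have e2 : 0 < μ (U ω) q (S q ω) := by
        refine div_pos (h0.trans_le (le_prEvt p hp ?_)) (h0.trans_le (le_prEvt p hp ?_))
        · exact ⟨rfl, rfl, hω⟩
        · exact ⟨rfl, hω⟩
      exact div_pos e2 e1
    have hPipos : 0 < Pi (U ω) := Finset.prod_pos fun q _ => hRpos q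
    rw [← Finset.mul_sum]
    have hs : ∑ q ∈ univ.filter (fun q => ¬ ∃ i, i < j ∧ a i = q), LLR p S M B G E a j q ω =
        Real.log (Pi (U ω)) / Real.log 2 := by
      simp only [hLL, Real.logb, Pi]
      rw [Real.log_prod (fun q _ => (hRpos q).ne'), Finset.sum_div]
    rw [hs]
    have hl1 : Real.log (Pi (U ω)) ≤ ((C : ℝ) + 2 * l + 1) * Real.log 2 + (Pi (U ω) / K - 1) := by
      have h5 := Real.log_le_sub_one_of_pos (div_pos hPipos hKpos)
      rw [Real.log_div hPipos.ne' hKpos.ne', hK, Real.log_pow] at h5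
      push_cast at h5
      linarith
    have : p ω * (Real.log (Pi (U ω)) / Real.log 2) ≤
        p ω * ((((C : ℝ) + 2 * l + 1) * Real.log 2 + (Pi (U ω) / K - 1)) / Real.log 2) := by
      gcongr
    refine this.trans (le_of_eq ?_)
    field_simp
    ring
  refine (Finset.sum_le_sum fun ω _ => hpt ω).trans ?_
  rw [Finset.sum_add_distrib, ← Finset.sum_mul, ← Finset.sum_div]
  have h6 : (∑ ω, (if ω ∈ E then p ω * Pi (U ω) else 0)) / (K * Real.log 2) ≤
      prEvt p E * K / (K * Real.log 2) := by gcongr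
  have h7 : prEvt p E * K / (K * Real.log 2) = prEvt p E * (1 / Real.log 2) := by
    field_simp
  change prEvt p E * _ + _ ≤ _
  rw [h7] at h6
  linarith

lemma decouple' {Ω ξ β : Type*} [Fintype Ω] [Fintype ξ] [Fintype β] (p : Ω → ℝ)
    (X : Ω → ξ) (V : Ω → β)
    (hind : ∀ x v, prEvt p {ω | X ω = x ∧ V ω = v} =
      prEvt p {ω | X ω = x} * prEvt p {ω | V ω = v}) (F : ξ → Ω → ℝ)
    (hF : ∀ x ω ω', V ω = V ω' → F x ω = F x ω') :
    ∑ ω, p ω * F (X ω) ω = ∑ x, prEvt p {ω | X ω = x} * ∑ ω, p ω * F x ω := by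
  let F' : ξ → β → ℝ := fun x v => if h : ∃ ω, V ω = v then F x h.choose else 0
  have h1 : ∀ x ω, F' x (V ω) = F x ω := by
    intro x ω
    have h : ∃ ω', V ω' = V ω := ⟨ω, rfl⟩
    simp only [F', h, dif_pos]
    exact hF _ _ _ h.choose_spec
  have h2 := decouple p X V hind F'
  simpa only [h1] using h2

lemma Zvar_agree {Ω α κ : Type*} {m l : ℕ} (S : Fin m → Ω → α) (M : Ω → κ)
    (B G : Fin m → Ω → Bool) (r r' : Fin l → Fin m) (j : Fin l)
    (h : ∀ i, i < j → r i = r' i) (ω : Ω) :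
    Zvar S M B G (fun _ => r) (fun _ => j) ω = Zvar S M B G (fun _ => r') (fun _ => j) ω := by
  simp only [Zvar, Prod.mk.injEq, true_and, and_true]
  refine ⟨?_, ?_, ?_, ?_⟩ <;>
  · funext i
    split_ifs with hi
    · rw [h i hi]
    · rfl

lemma Zvar_inv {Ω α κ : Type*} {m l : ℕ} (S : Fin m → Ω → α) (M : Ω → κ)
    (B G : Fin m → Ω → Bool) (r r' : Fin l → Fin m) (j j' : Fin l) (ω ω' : Ω)
    (h : Zvar S M B G (fun _ => r) (fun _ => j) ω = Zvar S M B G (fun _ => r') (fun _ => j') ω') :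
    j = j' ∧ ∀ i, i < j' → r i = r' i := by
  simp only [Zvar, Prod.mk.injEq] at h
  obtain ⟨-, h1, -, -, -, rfl⟩ := h
  refine ⟨rfl, fun i hi => ?_⟩
  have := congrFun h1 i
  simpa [hi] using this

/-- Replacing the random `(ρ, J)` by fixed values in the event `Z = z, ρ_J = q`. -/
lemma fix_prob {Ω α κ β : Type*} [Fintype Ω] [Fintype β] {m l : ℕ} (p : Ω → ℝ)
    (S : Fin m → Ω → α) (M : Ω → κ) (B G : Fin m → Ω → Bool)
    (ρ : Ω → Fin l → Fin m) (J : Ω → Fin l) (V : Ω → β)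
    (hind : ∀ x v, prEvt p {ω | (ρ ω, J ω) = x ∧ V ω = v} =
      prEvt p {ω | (ρ ω, J ω) = x} * prEvt p {ω | V ω = v})
    (hVS : ∀ ω ω', V ω = V ω' → ∀ i, S i ω = S i ω')
    (hVM : ∀ ω ω', V ω = V ω' → M ω = M ω')
    (hVB : ∀ ω ω', V ω = V ω' → ∀ i, B i ω = B i ω')
    (hVG : ∀ ω ω', V ω = V ω' → ∀ i, G i ω = G i ω')
    (T : Set Ω) (hT : ∀ ω ω', V ω = V ω' → (ω ∈ T ↔ ω' ∈ T)) (ω0 : Ω) :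
    prEvt p ({ω | Zvar S M B G ρ J ω = Zvar S M B G ρ J ω0} ∩
        {ω | ρ ω (J ω) = ρ ω0 (J ω0)} ∩ T) =
      (∑ x : (Fin l → Fin m) × Fin l, prEvt p {ω | (ρ ω, J ω) = x} *
        (if x.2 = J ω0 ∧ (∀ i, i < J ω0 → x.1 i = ρ ω0 i) ∧ x.1 (J ω0) = ρ ω0 (J ω0)
          then 1 else 0)) *
      prEvt p ({ω | Zvar S M B G (fun _ => ρ ω0) (fun _ => J ω0) ω =
        Zvar S M B G (fun _ => ρ ω0) (fun _ => J ω0) ω0} ∩ T) := by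
  rw [prEvt_eq_mul]
  have h := decouple' p (fun ω => (ρ ω, J ω)) V hind
    (fun x ω => if (Zvar S M B G (fun _ => x.1) (fun _ => x.2) ω =
      Zvar S M B G (fun _ => ρ ω0) (fun _ => J ω0) ω0 ∧ x.1 x.2 = ρ ω0 (J ω0)) ∧ ω ∈ T
      then 1 else 0) (by
        intro x ω ω' hv
        have e : Zvar S M B G (fun _ => x.1) (fun _ => x.2) ω =
            Zvar S M B G (fun _ => x.1) (fun _ => x.2) ω' := by
          simp only [Zvar, hVS ω ω' hv, hVM ω ω' hv, hVB ω ω' hv, hVG ω ω' hv]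
        simp only [e, hT ω ω' hv])
  refine Eq.trans ?_ (h.trans ?_)
  · refine Finset.sum_congr rfl fun ω _ => ?_
    congr 1
    have hiff : ω ∈ {ω | Zvar S M B G ρ J ω = Zvar S M B G ρ J ω0} ∩
        {ω | ρ ω (J ω) = ρ ω0 (J ω0)} ∩ T ↔
      (Zvar S M B G (fun _ => ρ ω) (fun _ => J ω) ω =
        Zvar S M B G (fun _ => ρ ω0) (fun _ => J ω0) ω0 ∧ ρ ω (J ω) = ρ ω0 (J ω0)) ∧ ω ∈ T :=
      Iff.rfl
    by_cases hh : ω ∈ {ω | Zvar S M B G ρ J ω = Zvar S M B G ρ J ω0} ∩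
        {ω | ρ ω (J ω) = ρ ω0 (J ω0)} ∩ T
    · rw [if_pos hh, if_pos (hiff.mp hh)]
    · rw [if_neg hh, if_neg (fun h' => hh (hiff.mpr h'))]
  · rw [Finset.sum_mul]
    refine Finset.sum_congr rfl fun x _ => ?_
    rw [mul_assoc]
    congr 1
    rw [prEvt_eq_mul, Finset.mul_sum]
    refine Finset.sum_congr rfl fun ω _ => ?_
    rw [mul_left_comm]
    congr 1
    by_cases hc : x.2 = J ω0 ∧ (∀ i, i < J ω0 → x.1 i = ρ ω0 i) ∧ x.1 (J ω0) = ρ ω0 (J ω0)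
    · rw [if_pos hc, one_mul]
      obtain ⟨r, j⟩ := x
      obtain ⟨h1, h2, h3⟩ := hc
      dsimp only at h1 h2 h3 ⊢
      subst h1
      have e := Zvar_agree S M B G r (ρ ω0) (J ω0) h2 ω
      simp [e, h3, Set.mem_inter_iff]
    · rw [if_neg hc, zero_mul, if_neg]
      rintro ⟨⟨h1, h2⟩, -⟩
      obtain ⟨h3, h4⟩ := Zvar_inv S M B G _ _ _ _ _ _ h1
      exact hc ⟨h3, h4, h3 ▸ h2⟩

set_option maxHeartbeats 2000000

/-- Low information on `S_{ρ_J}`: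
`E_{(z,q)∼(Z,ρ_J)|E}[ D( law(S_q | Z=z, ρ_J=q, E) ‖ law(S_q) ) ] ≤ 5(C+l)/m`. -/
theorem stmt13 {Ω α κ : Type*} [Fintype Ω] [Fintype α] [Fintype κ]
    (p : Ω → ℝ) (hp : ∀ ω, 0 ≤ p ω) (hsum : ∑ ω, p ω = 1)
    (m l C : ℕ) (hl1 : 1 ≤ l) (hlm : 2 * l ≤ m) (hC : 1 ≤ C)
    (S : Fin m → Ω → α)
    -- the `S_i` are independent …
    (hSindep : ∀ f : Fin m → α,
      prEvt p {ω | ∀ i, S i ω = f i} = ∏ i, prEvt p {ω | S i ω = f i})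
    -- … and identically distributed
    (hSident : ∀ (i j : Fin m) (x : α),
      prEvt p {ω | S i ω = x} = prEvt p {ω | S j ω = x})
    (E1 : Set Ω)
    -- `E¹` is independent of `(S_1,…,S_m)`
    (hE1indep : ∀ f : Fin m → α,
      prEvt p (E1 ∩ {ω | ∀ i, S i ω = f i}) =
        prEvt p E1 * prEvt p {ω | ∀ i, S i ω = f i})
    (M : Ω → κ)
    -- `M` takes at most `2^C` distinct values
    (hM : (Finset.univ.filter fun k : κ => prEvt p {ω | M ω = k} ≠ 0).card ≤ 2 ^ C)
    (E2 : Set Ω) (hE2 : 9 / 10 ≤ cprEvt p E2 E1)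
    (B G : Fin m → Ω → Bool)
    (ρ : Ω → Fin l → Fin m) (J : Ω → Fin l)
    -- `ρ` is a uniformly random injective sequence, `J` uniform on `[l]`
    (hρinj : ∀ ω, Function.Injective (ρ ω))
    (hρJunif : ∀ r : Fin l → Fin m, Function.Injective r → ∀ j : Fin l,
      prEvt p {ω | ρ ω = r ∧ J ω = j} = ((m.descFactorial l : ℝ) * l)⁻¹)
    -- `(ρ, J)` is independent of all of the above
    (hρJindep : ∀ (r : Fin l → Fin m) (j : Fin l)
        (v : (Fin m → α) × Bool × κ × Bool × (Fin m → Bool) × (Fin m → Bool)),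
      prEvt p {ω | ρ ω = r ∧ J ω = j ∧
          ((fun i => S i ω), (if ω ∈ E1 then true else false), M ω,
            (if ω ∈ E2 then true else false), (fun i => B i ω), (fun i => G i ω)) = v} =
        prEvt p {ω | ρ ω = r ∧ J ω = j} *
          prEvt p {ω | ((fun i => S i ω), (if ω ∈ E1 then true else false), M ω,
            (if ω ∈ E2 then true else false), (fun i => B i ω), (fun i => G i ω)) = v}) :
    ∑ z : κ × (Fin l → Option (Fin m)) × (Fin l → Option Bool) × (Fin l → Option Bool) ×
        (Fin l → Option α) × Fin l, ∑ q : Fin m,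
      cprEvt p ({ω | Zvar S M B G ρ J ω = z} ∩ {ω | ρ ω (J ω) = q}) (E1 ∩ E2) *
        klDiv2
          (fun x => cprEvt p {ω | S q ω = x}
            ({ω | Zvar S M B G ρ J ω = z} ∩ {ω | ρ ω (J ω) = q} ∩ (E1 ∩ E2)))
          (fun x => prEvt p {ω | S q ω = x})
      ≤ 5 * ((C : ℝ) + l) / m := by
  have hPE1 : 0 < prEvt p E1 := by
    rcases (prEvt_nonneg' p hp E1).eq_or_lt with h | h
    · rw [cprEvt, ← h, div_zero] at hE2; norm_num at hE2
    · exact h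
  have hPE : prEvt p E1 ≤ 2 * prEvt p (E1 ∩ E2) := by
    rw [cprEvt, le_div_iff₀ hPE1, Set.inter_comm] at hE2
    linarith
  let V : Ω → (Fin m → α) × Bool × κ × Bool × (Fin m → Bool) × (Fin m → Bool) := fun ω =>
    ((fun i => S i ω), (if ω ∈ E1 then true else false), M ω,
            (if ω ∈ E2 then true else false), (fun i => B i ω), (fun i => G i ω))
  have hVS : ∀ ω ω', V ω = V ω' → ∀ i, S i ω = S i ω' := by
    intro ω ω' h i
    simp only [V, Prod.mk.injEq] at h
    exact congrFun h.1 i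
  have hVM : ∀ ω ω', V ω = V ω' → M ω = M ω' := by
    intro ω ω' h
    simp only [V, Prod.mk.injEq] at h
    exact h.2.2.1
  have hVB : ∀ ω ω', V ω = V ω' → ∀ i, B i ω = B i ω' := by
    intro ω ω' h i
    simp only [V, Prod.mk.injEq] at h
    exact congrFun h.2.2.2.2.1 i
  have hVG : ∀ ω ω', V ω = V ω' → ∀ i, G i ω = G i ω' := by
    intro ω ω' h i
    simp only [V, Prod.mk.injEq] at h
    exact congrFun h.2.2.2.2.2 i
  have hVE : ∀ ω ω', V ω = V ω' → (ω ∈ E1 ∩ E2 ↔ ω' ∈ E1 ∩ E2) := by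
    intro ω ω' h
    simp only [V, Prod.mk.injEq] at h
    have h1 := h.2.1
    have h2 := h.2.2.2.1
    clear h
    have h3 : ω ∈ E1 ↔ ω' ∈ E1 := by
      by_cases a1 : ω ∈ E1 <;> by_cases a3 : ω' ∈ E1 <;> simp [a1, a3] at h1 ⊢
    have h4 : ω ∈ E2 ↔ ω' ∈ E2 := by
      by_cases a1 : ω ∈ E2 <;> by_cases a3 : ω' ∈ E2 <;> simp [a1, a3] at h2 ⊢
    exact and_congr h3 h4
  have hind : ∀ x v, prEvt p {ω | (ρ ω, J ω) = x ∧ V ω = v} =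
      prEvt p {ω | (ρ ω, J ω) = x} * prEvt p {ω | V ω = v} := by
    rintro ⟨r, j⟩ v
    have := hρJindep r j v
    simp only [Prod.mk.injEq, and_assoc] at this ⊢
    exact this
  have hEE : E1 ∩ E2 ⊆ E1 := Set.inter_subset_left
  clear hρJindep hE2
  generalize E1 ∩ E2 = E at *
  have hPEpos : 0 < prEvt p E := by linarith
  -- Step 1: rewrite the left-hand side as an average over the sample space
  have step1 : ∑ z : κ × (Fin l → Option (Fin m)) × (Fin l → Option Bool) ×
        (Fin l → Option Bool) × (Fin l → Option α) × Fin l, ∑ q : Fin m,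
      cprEvt p ({ω | Zvar S M B G ρ J ω = z} ∩ {ω | ρ ω (J ω) = q}) E *
        klDiv2
          (fun x => cprEvt p {ω | S q ω = x}
            ({ω | Zvar S M B G ρ J ω = z} ∩ {ω | ρ ω (J ω) = q} ∩ E))
          (fun x => prEvt p {ω | S q ω = x}) =
      (∑ ω, if ω ∈ E then p ω * Real.logb 2 (cprEvt p {ω' | S (ρ ω (J ω)) ω' = S (ρ ω (J ω)) ω}
            ({ω' | Zvar S M B G ρ J ω' = Zvar S M B G ρ J ω} ∩
              {ω' | ρ ω' (J ω') = ρ ω (J ω)} ∩ E) /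
            prEvt p {ω' | S (ρ ω (J ω)) ω' = S (ρ ω (J ω)) ω}) else 0) / prEvt p E := by
    have h := sum_fiber p (fun ω => (Zvar S M B G ρ J ω, ρ ω (J ω), S (ρ ω (J ω)) ω))
      (fun y => Real.logb 2 (cprEvt p {ω' | S y.2.1 ω' = y.2.2}
            ({ω' | Zvar S M B G ρ J ω' = y.1} ∩ {ω' | ρ ω' (J ω') = y.2.1} ∩ E) /
            prEvt p {ω' | S y.2.1 ω' = y.2.2})) E
    dsimp only at h
    rw [Fintype.sum_prod_type] at h
    rw [← h, Finset.sum_div]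
    refine Finset.sum_congr rfl fun z _ => ?_
    rw [Fintype.sum_prod_type, Finset.sum_div]
    refine Finset.sum_congr rfl fun q _ => ?_
    unfold klDiv2
    rw [Finset.mul_sum, Finset.sum_div]
    refine Finset.sum_congr rfl fun x _ => ?_
    rw [← mul_assoc, mul_div_right_comm]
    congr 1
    dsimp only
    have hset : {ω | S q ω = x} ∩ ({ω | Zvar S M B G ρ J ω = z} ∩ {ω | ρ ω (J ω) = q} ∩ E) =
        E ∩ {ω | (Zvar S M B G ρ J ω, ρ ω (J ω), S (ρ ω (J ω)) ω) = (z, q, x)} := by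
      ext ω
      simp only [Set.mem_inter_iff, Set.mem_setOf_eq, Prod.mk.injEq]
      constructor
      · rintro ⟨h1, ⟨h2, h3⟩, h4⟩
        exact ⟨h4, h2, h3, by rw [h3]; exact h1⟩
      · rintro ⟨h4, h2, h3, h1⟩
        exact ⟨by rw [h3] at h1; exact h1, ⟨h2, h3⟩, h4⟩
    unfold cprEvt
    rw [← hset]
    by_cases h0 : prEvt p ({ω | Zvar S M B G ρ J ω = z} ∩ {ω | ρ ω (J ω) = q} ∩ E) = 0
    · have h00 : prEvt p ({ω | S q ω = x} ∩
          ({ω | Zvar S M B G ρ J ω = z} ∩ {ω | ρ ω (J ω) = q} ∩ E)) = 0 :=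
        le_antisymm (h0 ▸ prEvt_mono' p hp Set.inter_subset_right) (prEvt_nonneg' p hp _)
      rw [h0, h00]; simp
    · field_simp
  -- Step 2: replace the random `(ρ, J)` in the likelihood ratio by its value
  have step2 : (∑ ω, if ω ∈ E then p ω * Real.logb 2
          (cprEvt p {ω' | S (ρ ω (J ω)) ω' = S (ρ ω (J ω)) ω}
            ({ω' | Zvar S M B G ρ J ω' = Zvar S M B G ρ J ω} ∩
              {ω' | ρ ω' (J ω') = ρ ω (J ω)} ∩ E) /
            prEvt p {ω' | S (ρ ω (J ω)) ω' = S (ρ ω (J ω)) ω}) else 0) =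
      ∑ ω, p ω * (if ω ∈ E then LLR p S M B G E (ρ ω) (J ω) (ρ ω (J ω)) ω else 0) := by
    refine Finset.sum_congr rfl fun ω _ => ?_
    by_cases hω : ω ∈ E
    swap
    · simp [hω]
    rw [if_pos hω, if_pos hω]
    rcases (hp ω).eq_or_lt with h0 | h0
    · simp [← h0]
    congr 1
    unfold LLR
    congr 2
    unfold cprEvt
    have hc : (∑ x : (Fin l → Fin m) × Fin l, prEvt p {ω | (ρ ω, J ω) = x} *
        (if x.2 = J ω ∧ (∀ i, i < J ω → x.1 i = ρ ω i) ∧ x.1 (J ω) = ρ ω (J ω)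
          then 1 else 0)) ≠ 0 := by
      apply ne_of_gt
      have h1 := Finset.single_le_sum (s := Finset.univ)
        (f := fun x : (Fin l → Fin m) × Fin l => prEvt p {ω | (ρ ω, J ω) = x} *
        (if x.2 = J ω ∧ (∀ i, i < J ω → x.1 i = ρ ω i) ∧ x.1 (J ω) = ρ ω (J ω)
          then (1 : ℝ) else 0)) (fun x _ => mul_nonneg (prEvt_nonneg' p hp _)
            (by split_ifs <;> norm_num)) (Finset.mem_univ (ρ ω, J ω))
      refine lt_of_lt_of_le ?_ h1
      simp only [implies_true, and_self, if_true, mul_one]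
      exact h0.trans_le (le_prEvt p hp (by rfl))
    have f1 := fix_prob p S M B G ρ J V hind hVS hVM hVB hVG E hVE ω
    have f2 := fix_prob p S M B G ρ J V hind hVS hVM hVB hVG
      ({ω' | S (ρ ω (J ω)) ω' = S (ρ ω (J ω)) ω} ∩ E) (by
        intro ω1 ω2 hv
        simp only [Set.mem_inter_iff, Set.mem_setOf_eq, hVS ω1 ω2 hv, hVE ω1 ω2 hv]) ω
    rw [Set.inter_left_comm, f1, f2, Set.inter_left_comm, mul_div_mul_left _ _ hc]
  -- Step 3: decouple
  have hagree : ∀ (j : Fin l) (r r' : Fin l → Fin m) q, (∀ i, i < j → r i = r' i) → ∀ ω,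
      LLR p S M B G E r j q ω = LLR p S M B G E r' j q ω := by
    intro j r r' q h ω
    simp only [LLR, Zvar_agree S M B G r r' j h]
  have step3 := decouple' p (fun ω => (ρ ω, J ω)) V hind
    (fun x ω => if ω ∈ E then LLR p S M B G E x.1 x.2 (x.1 x.2) ω else 0) (by
      intro x ω ω' hv
      have e : Zvar S M B G (fun _ => x.1) (fun _ => x.2) ω =
            Zvar S M B G (fun _ => x.1) (fun _ => x.2) ω' := by
          simp only [Zvar, hVS ω ω' hv, hVM ω ω' hv, hVB ω ω' hv, hVG ω ω' hv]
      simp only [LLR, e, hVE ω ω' hv, hVS ω ω' hv])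
  dsimp only at step3
  rw [step1, step2, step3]
  -- Step 4: bound
  let T : Fin l → (Fin l → Fin m) → Fin m → ℝ := fun j r q =>
    ∑ ω, (if ω ∈ E then p ω * LLR p S M B G E r j q ω else 0)
  let u : ℝ := ((m.descFactorial l : ℝ) * l)⁻¹
  let Inj := univ.filter (fun r : Fin l → Fin m => Function.Injective r)
  have hPX : ∀ r j, prEvt p {ω | (ρ ω, J ω) = (r, j)} =
      if Function.Injective r then u else 0 := by
    intro r j
    split_ifs with h
    · simp only [Prod.mk.injEq]
      exact hρJunif r h j
    · unfold prEvt
      refine Finset.sum_eq_zero fun ω _ => if_neg ?_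
      simp only [Set.mem_setOf_eq, Prod.mk.injEq]
      rintro ⟨h1, -⟩
      exact h (h1 ▸ hρinj ω)
  have hu : 0 ≤ u := by positivity
  have hnorm : (l : ℝ) * ((Inj.card : ℝ) * u) = 1 := by
    have h := sum_fiber p (fun ω => (ρ ω, J ω)) (fun _ => 1) Set.univ
    simp only [mul_one, Set.univ_inter, Set.mem_univ, if_true, hsum] at h
    rw [Fintype.sum_prod_type_right] at h
    simp only [hPX, ← Finset.sum_filter, Finset.sum_const, nsmul_eq_mul, Finset.card_univ,
      Fintype.card_fin] at h
    exact h
  have hsumEq : ∑ x : (Fin l → Fin m) × Fin l, prEvt p {ω | (ρ ω, J ω) = x} *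
      ∑ ω, p ω * (if ω ∈ E then LLR p S M B G E x.1 x.2 (x.1 x.2) ω else 0) =
      ∑ j : Fin l, u * ∑ r ∈ Inj, T j r (r j) := by
    rw [Fintype.sum_prod_type_right]
    refine Finset.sum_congr rfl fun j _ => ?_
    rw [Finset.mul_sum, Finset.sum_filter]
    refine Finset.sum_congr rfl fun r _ => ?_
    rw [hPX]
    by_cases h : Function.Injective r
    · simp only [h, if_true, T, mul_ite, mul_zero]
    · simp [h]
  rw [hsumEq]
  have hmpos : (0 : ℝ) < m := by
    have : 0 < m := by omega
    exact_mod_cast this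
  have hj : ∀ j : Fin l, u * ∑ r ∈ Inj, T j r (r j) ≤
      u * (Inj.card * (prEvt p E * ((C : ℝ) + 2 * l + 1)) * (2 / m)) := by
    intro j
    refine mul_le_mul_of_nonneg_left ?_ hu
    have hs := swap_sum j (T j) (by
      intro r r' q h
      simp only [T, hagree j r r' q h])
    have hb : ∑ r ∈ Inj, ∑ q ∈ univ.filter (fun q => ¬ ∃ i, i < j ∧ r i = q), T j r q ≤
        Inj.card * (prEvt p E * ((C : ℝ) + 2 * l + 1)) := by
      rw [← nsmul_eq_mul]
      refine Finset.sum_le_card_nsmul _ _ _ fun r _ => ?_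
      exact key_bound p hp hsum m l C S hSindep E1 hE1indep M hM E hEE hPE B G r j
    rw [hs] at hb
    have hd : (m : ℝ) / 2 ≤ (m : ℝ) - j := by
      have h1 : ((j : ℕ) : ℝ) ≤ l := by exact_mod_cast j.2.le
      have h2 : (2 : ℝ) * l ≤ m := by exact_mod_cast hlm
      linarith
    have hdpos : (0 : ℝ) < (m : ℝ) - j := by linarith
    rw [mul_comm, ← le_div_iff₀ hdpos] at hb
    refine hb.trans ?_
    rw [div_eq_mul_inv]
    refine mul_le_mul_of_nonneg_left ?_ (by positivity)
    rw [← inv_div]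
    exact inv_anti₀ (by positivity) hd
  have hfin : ∑ j : Fin l, u * ∑ r ∈ Inj, T j r (r j) ≤
      prEvt p E * (((C : ℝ) + 2 * l + 1) * (2 / m)) := by
    refine (Finset.sum_le_sum fun j _ => hj j).trans (le_of_eq ?_)
    rw [Finset.sum_const, nsmul_eq_mul, Finset.card_univ, Fintype.card_fin]
    calc _ = ((l : ℝ) * ((Inj.card : ℝ) * u)) *
          (prEvt p E * (((C : ℝ) + 2 * l + 1) * (2 / m))) := by ring
      _ = _ := by rw [hnorm, one_mul]
  rw [div_le_iff₀ hPEpos]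
  refine hfin.trans ?_
  rw [mul_comm]
  refine mul_le_mul_of_nonneg_right ?_ hPEpos.le
  rw [mul_div_assoc', div_le_div_iff_of_pos_right hmpos]
  have h1 : (1 : ℝ) ≤ C := by exact_mod_cast hC
  have h2 : (1 : ℝ) ≤ l := by exact_mod_cast hl1
  linarith
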